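/- arXiv:2104.14742 — 3 statements merged into one kernel-verified Lean document; each statement's English description precedes it below -/
import Mathlib

section
/- Let n ≥ 2. Then for every digraph D on n vertices without isolated vertices, χ_{−1}(D) ≤ n/4, and equality holds if and only if every arc (u,v) of D satisfies d⁺(u) = d⁻(v) and every vertex w of D satisfies d⁺(w) ≥ 1 and d⁻(w) ≥ 1. -/
open Finset

/-- The out-degree of a vertex `u` in the digraph on `Fin n` with arc set `A`. -/
def outDeg {n : ℕ} (A : Finset (Fin n × Fin n)) (u : Fin n) : ℕ :=
  (A.filter (fun a => a.1 = u)).card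

/-- The in-degree of a vertex `u` in the digraph on `Fin n` with arc set `A`. -/
def inDeg {n : ℕ} (A : Finset (Fin n × Fin n)) (u : Fin n) : ℕ :=
  (A.filter (fun a => a.2 = u)).card

/-- The vertex-degree-based invariant `I(D) = (1/2) ∑_{uv ∈ A} φ(d⁺(u), d⁻(v))`. -/
noncomputable def vdbI {n : ℕ} (A : Finset (Fin n × Fin n)) (φ : ℕ → ℕ → ℝ) : ℝ :=
  (1 / 2 : ℝ) * ∑ a ∈ A, φ (outDeg A a.1) (inDeg A a.2)

/-- `D` is (isomorphic to) the out-star `K⃗_{1,n-1}`: all arcs from a center `c`. -/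
def IsStarOut {n : ℕ} (A : Finset (Fin n × Fin n)) : Prop :=
  ∃ c : Fin n, A = Finset.univ.filter (fun a => a.1 = c ∧ a.2 ≠ c)

/-- `D` is (isomorphic to) the in-star `K⃗_{n-1,1}`: all arcs into a center `c`. -/
def IsStarIn {n : ℕ} (A : Finset (Fin n × Fin n)) : Prop :=
  ∃ c : Fin n, A = Finset.univ.filter (fun a => a.2 = c ∧ a.1 ≠ c)

/-- `D` is the complete symmetric digraph `K⃡_n`: all ordered pairs of distinct vertices. -/
def IsCompleteSym {n : ℕ} (A : Finset (Fin n × Fin n)) : Prop :=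
  A = Finset.univ.filter (fun a => a.1 ≠ a.2)

/-- The sum of the reciprocals of the fibre sizes, over all elements, counts the nonempty fibres. -/
theorem sum_inv_card_fiber {α β : Type*} [Fintype β] [DecidableEq β] (s : Finset α) (f : α → β) :
    ∑ a ∈ s, (((s.filter (fun x => f x = f a)).card : ℕ) : ℝ)⁻¹ =
      ((Finset.univ.filter (fun b => (s.filter (fun x => f x = b)).card ≠ 0)).card : ℝ) := by
  rw [← Finset.sum_fiberwise s f, Finset.card_filter, Nat.cast_sum]
  refine Finset.sum_congr rfl fun b _ => ?_
  have h : ∀ a ∈ s.filter (fun x => f x = b),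
      (((s.filter (fun x => f x = f a)).card : ℕ) : ℝ)⁻¹ =
        (((s.filter (fun x => f x = b)).card : ℕ) : ℝ)⁻¹ := by
    intro a ha
    rw [(Finset.mem_filter.mp ha).2]
  rw [Finset.sum_congr rfl h, Finset.sum_const, nsmul_eq_mul]
  by_cases hb : (s.filter (fun x => f x = b)).card = 0
  · simp only [hb, Nat.cast_zero, zero_mul, ne_eq, not_true_eq_false, if_false]
  · rw [if_pos hb, mul_inv_cancel₀ (Nat.cast_ne_zero.mpr hb), Nat.cast_one]

theorem sum_inv_outDeg {n : ℕ} (A : Finset (Fin n × Fin n)) :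
    ∑ a ∈ A, (outDeg A a.1 : ℝ)⁻¹ =
      ((Finset.univ.filter (fun u => outDeg A u ≠ 0)).card : ℝ) :=
  sum_inv_card_fiber A Prod.fst

theorem sum_inv_inDeg {n : ℕ} (A : Finset (Fin n × Fin n)) :
    ∑ a ∈ A, (inDeg A a.2 : ℝ)⁻¹ =
      ((Finset.univ.filter (fun u => inDeg A u ≠ 0)).card : ℝ) :=
  sum_inv_card_fiber A Prod.snd

theorem outDeg_pos_of_mem {n : ℕ} {A : Finset (Fin n × Fin n)} {a : Fin n × Fin n} (ha : a ∈ A) :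
    0 < outDeg A a.1 :=
  Finset.card_pos.mpr ⟨a, Finset.mem_filter.mpr ⟨ha, rfl⟩⟩

theorem inDeg_pos_of_mem {n : ℕ} {A : Finset (Fin n × Fin n)} {a : Fin n × Fin n} (ha : a ∈ A) :
    0 < inDeg A a.2 :=
  Finset.card_pos.mpr ⟨a, Finset.mem_filter.mpr ⟨ha, rfl⟩⟩

theorem inv_add_inv_div_four_sub_inv_add {x y : ℝ} (hx : 0 < x) (hy : 0 < y) :
    (x⁻¹ + y⁻¹) / 4 - (x + y)⁻¹ = (x - y) ^ 2 / (4 * x * y * (x + y)) := by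
  have : x + y ≠ 0 := by positivity
  field_simp
  ring

theorem inv_add_le_inv_add_inv_div_four {x y : ℝ} (hx : 0 < x) (hy : 0 < y) :
    (x + y)⁻¹ ≤ (x⁻¹ + y⁻¹) / 4 := by
  rw [← sub_nonneg, inv_add_inv_div_four_sub_inv_add hx hy]
  positivity

theorem inv_add_eq_inv_add_inv_div_four_iff {x y : ℝ} (hx : 0 < x) (hy : 0 < y) :
    (x + y)⁻¹ = (x⁻¹ + y⁻¹) / 4 ↔ x = y := by
  have h : 4 * x * y * (x + y) ≠ 0 := by positivity
  rw [eq_comm, ← sub_eq_zero, inv_add_inv_div_four_sub_inv_add hx hy, div_eq_zero_iff,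
    or_iff_left h, sq_eq_zero_iff, sub_eq_zero]

theorem card_filter_ne_zero_eq_iff {n : ℕ} (d : Fin n → ℕ) :
    (Finset.univ.filter (fun u => d u ≠ 0)).card = n ↔ ∀ u, 1 ≤ d u := by
  conv_lhs => rhs; rw [← Fintype.card_fin n, ← Finset.card_univ]
  rw [Finset.card_filter_eq_iff]
  simp only [Finset.mem_univ, true_imp_iff, Nat.one_le_iff_ne_zero]

theorem stmt12 (n : ℕ) (hn : 2 ≤ n)
    (A : Finset (Fin n × Fin n)) (harc : ∀ a ∈ A, a.1 ≠ a.2)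
    (hni : ∀ u : Fin n, outDeg A u ≠ 0 ∨ inDeg A u ≠ 0) :
    vdbI A (fun x y => ((x : ℝ) + (y : ℝ)) ^ (-1 : ℝ)) ≤ (n : ℝ) / 4 ∧
      (vdbI A (fun x y => ((x : ℝ) + (y : ℝ)) ^ (-1 : ℝ)) = (n : ℝ) / 4 ↔
        (∀ a ∈ A, outDeg A a.1 = inDeg A a.2) ∧
          ∀ w : Fin n, 1 ≤ outDeg A w ∧ 1 ≤ inDeg A w) := by
  simp only [vdbI, Real.rpow_neg_one]
  set P := (Finset.univ.filter (fun u => outDeg A u ≠ 0)).card with hP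
  set Q := (Finset.univ.filter (fun u => inDeg A u ≠ 0)).card with hQ
  have hsum : ∑ a ∈ A, ((outDeg A a.1 : ℝ)⁻¹ + (inDeg A a.2 : ℝ)⁻¹) / 4 = ((P : ℝ) + Q) / 4 := by
    rw [← Finset.sum_div, Finset.sum_add_distrib, sum_inv_outDeg, sum_inv_inDeg]
  have hx : ∀ a ∈ A, (0 : ℝ) < outDeg A a.1 := fun a ha => Nat.cast_pos.mpr (outDeg_pos_of_mem ha)
  have hy : ∀ a ∈ A, (0 : ℝ) < inDeg A a.2 := fun a ha => Nat.cast_pos.mpr (inDeg_pos_of_mem ha)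
  have hterm : ∀ a ∈ A, ((outDeg A a.1 : ℝ) + inDeg A a.2)⁻¹ ≤
      ((outDeg A a.1 : ℝ)⁻¹ + (inDeg A a.2 : ℝ)⁻¹) / 4 :=
    fun a ha => inv_add_le_inv_add_inv_div_four (hx a ha) (hy a ha)
  have hle := Finset.sum_le_sum hterm
  have heq := Finset.sum_eq_sum_iff_of_le hterm
  have harcs : (∀ a ∈ A, ((outDeg A a.1 : ℝ) + inDeg A a.2)⁻¹ =
      ((outDeg A a.1 : ℝ)⁻¹ + (inDeg A a.2 : ℝ)⁻¹) / 4) ↔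
        ∀ a ∈ A, outDeg A a.1 = inDeg A a.2 :=
    forall₂_congr fun a ha =>
      (inv_add_eq_inv_add_inv_div_four_iff (hx a ha) (hy a ha)).trans Nat.cast_inj
  rw [harcs, hsum] at heq
  rw [hsum] at hle
  have hPn : (P : ℝ) ≤ n := by exact_mod_cast card_finset_fin_le _
  have hQn : (Q : ℝ) ≤ n := by exact_mod_cast card_finset_fin_le _
  refine ⟨by linarith, ?_⟩
  rw [forall_and, ← card_filter_ne_zero_eq_iff (outDeg A), ← card_filter_ne_zero_eq_iff (inDeg A),
    ← heq, ← hP, ← hQ, ← Nat.cast_inj (R := ℝ), ← Nat.cast_inj (R := ℝ) (m := Q)]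
  constructor
  · intro h
    refine ⟨?_, ?_, ?_⟩ <;> linarith
  · rintro ⟨h, h₁, h₂⟩
    linarith
end

section
/- Let n ≥ 6 and let α be a real number with −1 ≤ α ≤ −1/2. Then for every digraph D on n vertices without isolated vertices, χ_α(D) ≥ (1/2)·(n−1)·n^α, and equality holds if and only if D is isomorphic to K⃗_{1,n−1} or to K⃗_{n−1,1}. -/
open Finset

/-- The value `∑ (d⁺(u) + d⁻(v)) ^ α` attained by a star on `k` vertices. -/
noncomputable def starSum (α : ℝ) (k : ℕ) : ℝ := ((k : ℝ) - 1) * (k : ℝ) ^ α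

theorem two_mul_rpow_lt_add {α : ℝ} (hα : α < 0) {x : ℝ} (hx : 0 < x) :
    2 * (x + 1) ^ α < x ^ α + (x + 2) ^ α := by
  have hx2 : 0 < x + 2 := by linarith
  have h1 : (x + 1) ^ α = ((x + 1) ^ 2) ^ (α / 2) := by
    rw [← Real.rpow_natCast, ← Real.rpow_mul (by linarith)]
    congr 1
    push_cast
    ring
  have h2 : ((x + 1) ^ 2) ^ (α / 2) < (x * (x + 2)) ^ (α / 2) :=
    Real.rpow_lt_rpow_of_neg (by positivity) (by nlinarith) (by linarith)
  rw [Real.mul_rpow hx.le hx2.le] at h2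
  have h3 : ∀ y : ℝ, 0 < y → y ^ α = (y ^ (α / 2)) ^ 2 := fun y hy => by
    rw [← Real.rpow_natCast, ← Real.rpow_mul hy.le]
    congr 1
    push_cast
    ring
  rw [h1, h3 x hx, h3 (x + 2) hx2]
  nlinarith [sq_nonneg (x ^ (α / 2) - (x + 2) ^ (α / 2))]

theorem add_rpow_le_two_mul {p : ℝ} (hp₀ : 0 ≤ p) (hp₁ : p ≤ 1) {x : ℝ} (hx : 0 < x) :
    x ^ p + (x + 2) ^ p ≤ 2 * (x + 1) ^ p := by
  have h := (Real.concaveOn_rpow hp₀ hp₁).2 (Set.mem_Ici.2 hx.le)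
    (Set.mem_Ici.2 (by linarith : 0 ≤ x + 2)) (by norm_num : (0 : ℝ) ≤ 1 / 2)
    (by norm_num : (0 : ℝ) ≤ 1 / 2) (by norm_num)
  simp only [smul_eq_mul] at h
  rw [show 1 / 2 * x + 1 / 2 * (x + 2) = x + 1 by ring] at h
  linarith

theorem mul_rpow_le_rpow {α : ℝ} (hα : α ≤ -(1 / 2)) {c x y : ℝ} (hc : 1 ≤ c) (hx : 0 < x)
    (h : c ^ 2 * x ≤ y) : c * y ^ α ≤ x ^ α := by
  have hy : 0 < y := lt_of_lt_of_le (by positivity) h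
  have hr : c ^ 2 ≤ y / x := (le_div_iff₀ hx).2 h
  have h1 : c ≤ (y / x) ^ (1 / 2 : ℝ) := by
    rw [← Real.sqrt_eq_rpow]
    exact Real.le_sqrt_of_sq_le hr
  have h2 : (y / x) ^ (1 / 2 : ℝ) ≤ (y / x) ^ (-α) :=
    Real.rpow_le_rpow_of_exponent_le (by nlinarith) (by linarith)
  have h3 : (y / x) ^ (-α) = x ^ α / y ^ α := by
    rw [Real.div_rpow hy.le hx.le, Real.rpow_neg hy.le, Real.rpow_neg hx.le]
    field_simp
  rw [← le_div_iff₀ (Real.rpow_pos_of_pos hy α), ← h3]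
  exact h1.trans h2

theorem starSum_eq_sub {α : ℝ} {k : ℕ} (hk : 0 < k) :
    starSum α k = (k : ℝ) ^ (α + 1) - (k : ℝ) ^ α := by
  have : (0 : ℝ) < k := by exact_mod_cast hk
  rw [starSum, Real.rpow_add_one this.ne']
  ring

theorem starSum_lt_succ {α : ℝ} (hα₁ : -1 ≤ α) (hα : α < 0) {k : ℕ} (hk : 0 < k) :
    starSum α k < starSum α (k + 1) := by
  have hk' : (0 : ℝ) < k := by exact_mod_cast hk
  rw [starSum_eq_sub hk, starSum_eq_sub k.succ_pos]
  push_cast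
  have h1 : (k : ℝ) ^ (α + 1) ≤ ((k : ℝ) + 1) ^ (α + 1) :=
    Real.rpow_le_rpow hk'.le (by linarith) (by linarith)
  have h2 : ((k : ℝ) + 1) ^ α < (k : ℝ) ^ α := Real.rpow_lt_rpow_of_neg hk' (by linarith) hα
  linarith

theorem starSum_mono {α : ℝ} (hα₁ : -1 ≤ α) (hα : α < 0) {j k : ℕ} (hj : 0 < j) (hjk : j ≤ k) :
    starSum α j ≤ starSum α k := by
  induction k, hjk using Nat.le_induction with
  | base => exact le_rfl
  | succ k hk ih => exact ih.trans (starSum_lt_succ hα₁ hα (hj.trans_le hk)).le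

theorem starSum_step_lt {α : ℝ} (hα₁ : -1 ≤ α) (hα : α < 0) {k : ℕ} (hk : 0 < k) :
    starSum α (k + 2) - starSum α (k + 1) < starSum α (k + 1) - starSum α k := by
  have hk' : (0 : ℝ) < k := by exact_mod_cast hk
  rw [starSum_eq_sub hk, starSum_eq_sub k.succ_pos, starSum_eq_sub (Nat.succ_pos (k + 1))]
  push_cast
  rw [show (k : ℝ) + 1 + 1 = k + 2 by ring]
  linarith [two_mul_rpow_lt_add hα hk',
    add_rpow_le_two_mul (p := α + 1) (by linarith) (by linarith) hk']

theorem starSum_step_anti {α : ℝ} (hα₁ : -1 ≤ α) (hα : α < 0) {j k : ℕ} (hj : 0 < j)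
    (hjk : j ≤ k) : starSum α (k + 1) - starSum α k ≤ starSum α (j + 1) - starSum α j := by
  induction k, hjk using Nat.le_induction with
  | base => exact le_rfl
  | succ k hk ih => exact (starSum_step_lt hα₁ hα (hj.trans_le hk)).le.trans ih

theorem starSum_step_strictAnti {α : ℝ} (hα₁ : -1 ≤ α) (hα : α < 0) {j k : ℕ} (hj : 0 < j)
    (hjk : j < k) : starSum α (k + 1) - starSum α k < starSum α (j + 1) - starSum α j :=
  (starSum_step_anti hα₁ hα j.succ_pos hjk).trans_lt (starSum_step_lt hα₁ hα hj)

theorem rpow_step_anti {α : ℝ} (hα : α < 0) {j k : ℕ} (hj : 0 < j) (hjk : j ≤ k) :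
    (k : ℝ) ^ α - ((k : ℝ) + 1) ^ α ≤ (j : ℝ) ^ α - ((j : ℝ) + 1) ^ α := by
  induction k, hjk using Nat.le_induction with
  | base => exact le_rfl
  | succ k hk ih =>
    have h := two_mul_rpow_lt_add hα (x := k) (by exact_mod_cast hj.trans_le hk)
    push_cast
    rw [show (k : ℝ) + 1 + 1 = k + 2 by ring]
    linarith

theorem starSum_add_two_lt {α : ℝ} (hα₁ : -1 ≤ α) (hα₂ : α ≤ -(1 / 2)) {k : ℕ} (hk : 3 ≤ k) :
    starSum α (k + 2) < starSum α k + 2 ^ α := by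
  have h1 := starSum_step_anti hα₁ (by linarith) (by norm_num) hk
  have h2 := starSum_step_anti hα₁ (by linarith) (by norm_num) (Nat.succ_le_succ hk)
  have h3 := mul_rpow_le_rpow hα₂ (c := 1.29) (x := 3) (y := 5) (by norm_num) (by norm_num)
    (by norm_num)
  have h4 := mul_rpow_le_rpow hα₂ (c := 1.58) (x := 2) (y := 5) (by norm_num) (by norm_num)
    (by norm_num)
  have h5 : (0 : ℝ) < 5 ^ α := by positivity
  have e3 : starSum α 3 = 2 * 3 ^ α := by norm_num [starSum]
  have e5 : starSum α (3 + 1 + 1) = 4 * 5 ^ α := by norm_num [starSum]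
  simp only [Nat.succ_eq_add_one] at h2
  have e : starSum α (k + 2) = starSum α (k + 1 + 1) := rfl
  linarith

theorem starSum_six_lt {α : ℝ} (hα₂ : α ≤ -(1 / 2)) : starSum α 6 < 3 * 2 ^ α := by
  have h := mul_rpow_le_rpow hα₂ (c := 1.7) (x := 2) (y := 6) (by norm_num) (by norm_num)
    (by norm_num)
  have h5 : (0 : ℝ) < 6 ^ α := by positivity
  have e : starSum α 6 = 5 * 6 ^ α := by norm_num [starSum]
  linarith

section Fibers

variable {ι β : Type*} [DecidableEq β]

theorem card_fiber_eq_erase_add [DecidableEq ι] (f : ι → β) {s : Finset ι} {e : ι} (he : e ∈ s) (u : β) :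
    #{a ∈ s | f a = u} = #{a ∈ s.erase e | f a = u} + if f e = u then 1 else 0 := by
  rw [Finset.filter_erase]
  split_ifs with h
  · rw [Finset.card_erase_add_one (by simp [he, h])]
  · rw [Finset.erase_eq_of_notMem (by simp [h]), add_zero]

theorem card_image_eq_erase_add [DecidableEq ι] (f : ι → β) {s : Finset ι} {e : ι} (he : e ∈ s) :
    #(s.image f) = #((s.erase e).image f) + if #{a ∈ s | f a = f e} = 1 then 1 else 0 := by
  have h := card_fiber_eq_erase_add f he (f e)
  have hs : s.image f = insert (f e) ((s.erase e).image f) := by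
    rw [← Finset.image_insert, Finset.insert_erase he]
  rw [if_pos rfl] at h
  rw [hs]
  split_ifs with h1
  · have h0 : #{a ∈ s.erase e | f a = f e} = 0 := by omega
    rw [Finset.card_insert_of_notMem]
    rw [Finset.card_eq_zero, Finset.filter_eq_empty_iff] at h0
    rw [Finset.mem_image]
    rintro ⟨a, ha, hae⟩
    exact h0 ha hae
  · have h0 : 0 < #{a ∈ s.erase e | f a = f e} := by omega
    obtain ⟨a, ha⟩ := Finset.card_pos.1 h0
    rw [Finset.mem_filter] at ha
    rw [Finset.insert_eq_of_mem (Finset.mem_image.2 ⟨a, ha⟩), add_zero]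

theorem card_fiber_pos (f : ι → β) {s : Finset ι} {e : ι} (he : e ∈ s) :
    0 < #{a ∈ s | f a = f e} :=
  Finset.card_pos.2 ⟨e, by simp [he]⟩

theorem card_fiber_le_card_image {γ : Type*} [DecidableEq γ] (f : ι → β) (g : ι → γ)
    (hfg : ∀ a b, f a = f b → g a = g b → a = b) (s : Finset ι) (u : β) :
    #{a ∈ s | f a = u} ≤ #(s.image g) := by
  refine Finset.card_le_card_of_injOn g (fun a ha => ?_) fun a ha b hb hab => ?_
  · simp only [Finset.coe_filter, Set.mem_ofPred_eq] at ha
    exact Finset.mem_coe.2 (Finset.mem_image_of_mem g ha.1)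
  · simp only [Finset.coe_filter, Set.mem_ofPred_eq] at ha hb
    exact hfg a b (ha.2.trans hb.2.symm) hab

theorem exists_card_fibers_eq_one {γ : Type*} [DecidableEq γ] (f : ι → β) (g : ι → γ)
    {s : Finset ι} (hs : #s < 2 * #(s.image f)) (hg : #(s.image g) = #s) :
    ∃ a ∈ s, #{b ∈ s | f b = f a} = 1 ∧ #{b ∈ s | g b = g a} = 1 := by
  have hinj : Set.InjOn g s := Finset.card_image_iff.1 hg
  obtain ⟨u, hu, hu2⟩ : ∃ u ∈ s.image f, #{b ∈ s | f b = u} < 2 := by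
    refine Finset.exists_lt_of_sum_lt ?_
    rw [← Finset.card_eq_sum_card_image, Finset.sum_const, smul_eq_mul]
    omega
  obtain ⟨a, ha, rfl⟩ := Finset.mem_image.1 hu
  refine ⟨a, ha, ?_, ?_⟩
  · have := card_fiber_pos f ha
    omega
  · rw [Finset.card_eq_one]
    refine ⟨a, Finset.ext fun b => ?_⟩
    simp only [Finset.mem_filter, Finset.mem_singleton]
    refine ⟨fun h => hinj h.1 ha h.2, ?_⟩
    rintro rfl
    exact ⟨ha, rfl⟩

end Fibers

/-- The sum `∑ (d⁺(u) + d⁻(v)) ^ α` over the arcs, that is `2 χ_α`. -/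
noncomputable def arcSum {n : ℕ} (α : ℝ) (A : Finset (Fin n × Fin n)) : ℝ :=
  ∑ a ∈ A, ((outDeg A a.1 : ℝ) + (inDeg A a.2 : ℝ)) ^ α

section ArcSum

variable {n : ℕ} {A : Finset (Fin n × Fin n)} {e : Fin n × Fin n}

theorem outDeg_eq_erase_add (he : e ∈ A) (u : Fin n) :
    outDeg A u = outDeg (A.erase e) u + if e.1 = u then 1 else 0 :=
  card_fiber_eq_erase_add Prod.fst he u

theorem inDeg_eq_erase_add (he : e ∈ A) (u : Fin n) :
    inDeg A u = inDeg (A.erase e) u + if e.2 = u then 1 else 0 :=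
  card_fiber_eq_erase_add Prod.snd he u

theorem card_image_fst_eq (he : e ∈ A) :
    #(A.image Prod.fst) =
      #((A.erase e).image Prod.fst) + if outDeg A e.1 = 1 then 1 else 0 :=
  card_image_eq_erase_add Prod.fst he

theorem card_image_snd_eq (he : e ∈ A) :
    #(A.image Prod.snd) =
      #((A.erase e).image Prod.snd) + if inDeg A e.2 = 1 then 1 else 0 :=
  card_image_eq_erase_add Prod.snd he

theorem outDeg_pos (he : e ∈ A) : 0 < outDeg A e.1 := card_fiber_pos Prod.fst he

theorem inDeg_pos (he : e ∈ A) : 0 < inDeg A e.2 := card_fiber_pos Prod.snd he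

theorem outDeg_le (A : Finset (Fin n × Fin n)) (u : Fin n) : outDeg A u ≤ #(A.image Prod.snd) :=
  card_fiber_le_card_image Prod.fst Prod.snd (fun _ _ => Prod.ext) A u

theorem inDeg_le (A : Finset (Fin n × Fin n)) (u : Fin n) : inDeg A u ≤ #(A.image Prod.fst) :=
  card_fiber_le_card_image Prod.snd Prod.fst (fun _ _ h h' => Prod.ext h' h) A u

/-- Deleting an arc whose degree sum `s` is minimal lowers the sum by at least the increment of
`starSum` from `s - 1` to `s`. -/
theorem arcSum_erase_add_le {α : ℝ} (hα : α < 0) (he : e ∈ A) {s : ℕ}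
    (hs : outDeg A e.1 + inDeg A e.2 = s + 1)
    (hmin : ∀ a ∈ A, s + 1 ≤ outDeg A a.1 + inDeg A a.2) :
    arcSum α (A.erase e) + (starSum α (s + 1) - starSum α s) ≤ arcSum α A := by
  have hs0 : 0 < s := by
    have := outDeg_pos he
    have := inDeg_pos he
    omega
  set c : ℝ := (s : ℝ) ^ α - ((s : ℝ) + 1) ^ α with hc
  have hterm : ∀ a ∈ A.erase e,
      ((outDeg (A.erase e) a.1 : ℝ) + (inDeg (A.erase e) a.2 : ℝ)) ^ α -
        (((if e.1 = a.1 then 1 else 0 : ℕ) : ℝ) + ((if e.2 = a.2 then 1 else 0 : ℕ) : ℝ)) * c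
        ≤ ((outDeg A a.1 : ℝ) + (inDeg A a.2 : ℝ)) ^ α := by
    intro a ha
    have hm := hmin a (Finset.mem_of_mem_erase ha)
    have hne : ¬(e.1 = a.1 ∧ e.2 = a.2) := fun h =>
      Finset.ne_of_mem_erase ha (Prod.ext h.1.symm h.2.symm)
    rw [outDeg_eq_erase_add he, inDeg_eq_erase_add he] at hm ⊢
    set p := outDeg (A.erase e) a.1
    set q := inDeg (A.erase e) a.2
    by_cases h1 : e.1 = a.1
    · have h2 : e.2 ≠ a.2 := fun h2 => hne ⟨h1, h2⟩
      simp only [h1, h2, if_true, if_false] at hm ⊢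
      have := rpow_step_anti hα hs0 (k := p + q) (by omega)
      push_cast at this ⊢
      rw [show (p : ℝ) + 1 + (q + 0) = p + q + 1 by ring]
      linarith
    · by_cases h2 : e.2 = a.2
      · simp only [h1, h2, if_true, if_false] at hm ⊢
        have := rpow_step_anti hα hs0 (k := p + q) (by omega)
        push_cast at this ⊢
        rw [show (p : ℝ) + 0 + (q + 1) = p + q + 1 by ring]
        linarith
      · simp [h1, h2]
  have hsum := Finset.sum_le_sum hterm
  rw [Finset.sum_sub_distrib, ← Finset.sum_mul, Finset.sum_add_distrib, ← Nat.cast_sum,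
    ← Nat.cast_sum, ← Finset.card_filter, ← Finset.card_filter] at hsum
  have ho := outDeg_eq_erase_add he e.1
  have hi := inDeg_eq_erase_add he e.2
  have hcount : #{a ∈ A.erase e | e.1 = a.1} + #{a ∈ A.erase e | e.2 = a.2} + 1 = s := by
    simp only [eq_comm (a := e.1), eq_comm (a := e.2)]
    simp only [if_true, outDeg, inDeg] at ho hi hs
    omega
  have hsplit : arcSum α A = ((outDeg A e.1 : ℝ) + (inDeg A e.2 : ℝ)) ^ α +
      ∑ a ∈ A.erase e, ((outDeg A a.1 : ℝ) + (inDeg A a.2 : ℝ)) ^ α :=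
    (Finset.add_sum_erase A (fun a => ((outDeg A a.1 : ℝ) + (inDeg A a.2 : ℝ)) ^ α) he).symm
  have hcount' : (#{a ∈ A.erase e | e.1 = a.1} : ℝ) + #{a ∈ A.erase e | e.2 = a.2} = s - 1 := by
    rw [← hcount]
    push_cast
    ring
  have hs' : (outDeg A e.1 : ℝ) + (inDeg A e.2 : ℝ) = s + 1 := by exact_mod_cast hs
  rw [hcount'] at hsum
  rw [hsplit, hs', starSum, starSum, arcSum]
  push_cast
  rw [hc] at hsum
  linarith

theorem card_mul_rpow_le_arcSum {α : ℝ} (hα : α < 0) (A : Finset (Fin n × Fin n)) :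
    (#A : ℝ) * ((#(A.image Prod.fst) + #(A.image Prod.snd) : ℕ) : ℝ) ^ α ≤ arcSum α A := by
  rw [← nsmul_eq_mul, arcSum]
  refine Finset.card_nsmul_le_sum _ _ _ fun a ha => ?_
  have h1 := outDeg_pos ha
  have h2 := outDeg_le A a.1
  have h3 := inDeg_le A a.2
  refine Real.rpow_le_rpow_of_nonpos ?_ ?_ hα.le
  · positivity
  · exact_mod_cast (by omega)

theorem card_le_mul_card_images (A : Finset (Fin n × Fin n)) :
    #A ≤ #(A.image Prod.fst) * #(A.image Prod.snd) := by
  rw [← Finset.card_product]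
  exact Finset.card_le_card Finset.subset_product

/-- If `N` is the number of tails plus the number of heads, then `arcSum α A` is at least
`starSum α N` unless `A` consists of two arcs with distinct tails and distinct heads. For `N > 4`
equality forces a single tail or a single head. -/
theorem starSum_le_arcSum {α : ℝ} (hα₁ : -1 ≤ α) (hα₂ : α ≤ -(1 / 2))
    (A : Finset (Fin n × Fin n)) :
    (#A = 2 ∧ #(A.image Prod.fst) + #(A.image Prod.snd) = 4 ∧ 2 * 2 ^ α ≤ arcSum α A) ∨
      (starSum α (#(A.image Prod.fst) + #(A.image Prod.snd)) ≤ arcSum α A ∧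
        (arcSum α A = starSum α (#(A.image Prod.fst) + #(A.image Prod.snd)) →
          #(A.image Prod.fst) + #(A.image Prod.snd) ≤ 4 ∨
            #(A.image Prod.fst) = 1 ∨ #(A.image Prod.snd) = 1)) := by
  have hα : α < 0 := by linarith
  induction A using Finset.strongInduction with
  | H A ih =>
  rcases A.eq_empty_or_nonempty with rfl | hA
  · right
    simp [starSum, arcSum, Real.zero_rpow hα.ne]
  obtain ⟨e, he, hmin⟩ := A.exists_min_image (fun a => outDeg A a.1 + inDeg A a.2) hA
  have IH := ih _ (Finset.erase_ssubset he)
  have ho := outDeg_pos he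
  have hi := inDeg_pos he
  have hoR := outDeg_le A e.1
  have hiL := inDeg_le A e.2
  obtain ⟨s, hs⟩ : ∃ s, outDeg A e.1 + inDeg A e.2 = s + 1 := ⟨_, (Nat.succ_pred (by omega)).symm⟩
  have hdel := arcSum_erase_add_le hα he hs fun a ha => hs ▸ hmin a ha
  have hL := card_image_fst_eq he
  have hR := card_image_snd_eq he
  have hcard := Finset.card_erase_add_one he
  have hLA : #(A.image Prod.fst) ≤ #A := Finset.card_image_le
  have hRA : #(A.image Prod.snd) ≤ #A := Finset.card_image_le
  have hprod := card_le_mul_card_images (A.erase e)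
  have hL0 : #((A.erase e).image Prod.fst) = 0 → #(A.erase e) = 0 := fun h => by
    rw [h] at hprod; omega
  have hR0 : #((A.erase e).image Prod.snd) = 0 → #(A.erase e) = 0 := fun h => by
    rw [h] at hprod; omega
  have hLA' : #((A.erase e).image Prod.fst) ≤ #(A.erase e) := Finset.card_image_le
  have hRA' : #((A.erase e).image Prod.snd) ≤ #(A.erase e) := Finset.card_image_le
  have hmul := card_mul_rpow_le_arcSum hα A
  have key : #A = 3 → #(A.image Prod.fst) + #(A.image Prod.snd) = 5 → s + 1 = 2 := by
    intro h3 h5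
    have : ∃ a ∈ A, outDeg A a.1 = 1 ∧ inDeg A a.2 = 1 := by
      by_cases h : #(A.image Prod.snd) = 3
      · exact exists_card_fibers_eq_one Prod.fst Prod.snd (by omega) (by omega)
      · obtain ⟨a, ha, h1, h2⟩ := exists_card_fibers_eq_one Prod.snd Prod.fst
          (s := A) (by omega) (by omega)
        exact ⟨a, ha, h2, h1⟩
    obtain ⟨a, ha, h1, h2⟩ := this
    have := hmin a ha
    omega
  generalize #(A.image Prod.fst) = L at *
  generalize #(A.image Prod.snd) = R at *
  generalize #((A.erase e).image Prod.fst) = L' at *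
  generalize #((A.erase e).image Prod.snd) = R' at *
  by_cases h1 : outDeg A e.1 = 1 <;> by_cases h2 : inDeg A e.2 = 1
  · rw [if_pos h1] at hL
    rw [if_pos h2] at hR
    obtain rfl : s = 1 := by omega
    have e1 : starSum α (1 + 1) - starSum α 1 = 2 ^ α := by norm_num [starSum]
    rw [e1] at hdel
    rcases IH with ⟨hc, hN, hb⟩ | ⟨hb, -⟩
    · right
      have h6 := starSum_six_lt hα₂
      rw [show L + R = 6 by omega]
      exact ⟨by linarith, fun h => by linarith⟩
    · rw [show L + R = L' + R' + 2 by omega]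
      have hcases : L' + R' = 0 ∨ L' + R' = 2 ∨ 3 ≤ L' + R' := by omega
      rcases hcases with h0 | h0 | h0
      · right
        have hz : starSum α 0 = 0 := by simp [starSum, Real.zero_rpow hα.ne]
        have ht : starSum α (0 + 2) = 2 ^ α := by norm_num [starSum]
        rw [h0] at hb ⊢
        exact ⟨by linarith, fun _ => by omega⟩
      · left
        have ht : starSum α 2 = 2 ^ α := by norm_num [starSum]
        rw [h0, ht] at hb
        obtain ⟨rfl, rfl⟩ : L' = 1 ∧ R' = 1 := by omega
        exact ⟨by omega, by omega, by linarith⟩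
      · right
        have := starSum_add_two_lt hα₁ hα₂ h0
        exact ⟨by linarith, fun h => by linarith⟩
  · rw [if_pos h1] at hL
    rw [if_neg h2] at hR
    rcases IH with ⟨hc, hN, hb⟩ | ⟨hb, -⟩
    · have := key (by omega) (by omega)
      omega
    · right
      obtain ⟨k, hk⟩ : ∃ k, L + R = k + 1 := ⟨L' + R', by omega⟩
      rw [show L' + R' = k by omega] at hb
      rw [hk]
      have := starSum_step_anti hα₁ hα (j := s) (k := k) (by omega) (by omega)
      refine ⟨by linarith, fun h => ?_⟩
      by_contra hcon
      have := starSum_step_strictAnti hα₁ hα (j := s) (k := k) (by omega) (by omega)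
      linarith
  · rw [if_neg h1] at hL
    rw [if_pos h2] at hR
    rcases IH with ⟨hc, hN, hb⟩ | ⟨hb, -⟩
    · have := key (by omega) (by omega)
      omega
    · right
      obtain ⟨k, hk⟩ : ∃ k, L + R = k + 1 := ⟨L' + R', by omega⟩
      rw [show L' + R' = k by omega] at hb
      rw [hk]
      have := starSum_step_anti hα₁ hα (j := s) (k := k) (by omega) (by omega)
      refine ⟨by linarith, fun h => ?_⟩
      by_contra hcon
      have := starSum_step_strictAnti hα₁ hα (j := s) (k := k) (by omega) (by omega)
      linarith
  · rw [if_neg h1] at hL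
    rw [if_neg h2] at hR
    right
    rcases IH with ⟨hc, hN, hb⟩ | ⟨hb, -⟩
    · rw [show L + R = 4 by omega] at hmul ⊢
      rw [show #A = 3 by omega] at hmul
      refine ⟨le_of_eq_of_le ?_ hmul, fun _ => by omega⟩
      norm_num [starSum]
    · have := starSum_lt_succ hα₁ hα (k := s) (by omega)
      rw [show L' + R' = L + R by omega] at hb
      exact ⟨by linarith, fun h => by linarith⟩

theorem card_le_card_images_add (hni : ∀ u : Fin n, outDeg A u ≠ 0 ∨ inDeg A u ≠ 0) :
    n ≤ #(A.image Prod.fst) + #(A.image Prod.snd) := by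
  have h : (Finset.univ : Finset (Fin n)) ⊆ A.image Prod.fst ∪ A.image Prod.snd := by
    intro u _
    rw [Finset.mem_union, Finset.mem_image, Finset.mem_image]
    refine (hni u).imp (fun h => ?_) fun h => ?_ <;>
    · obtain ⟨a, ha⟩ := Finset.card_pos.1 (Nat.pos_of_ne_zero h)
      exact ⟨a, Finset.mem_filter.1 ha⟩
  simpa using (Finset.card_le_card h).trans (Finset.card_union_le _ _)

theorem isStarOut_of_card_image_fst (harc : ∀ a ∈ A, a.1 ≠ a.2)
    (hni : ∀ u : Fin n, outDeg A u ≠ 0 ∨ inDeg A u ≠ 0) (h : #(A.image Prod.fst) = 1) :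
    IsStarOut A := by
  obtain ⟨c, hc⟩ := Finset.card_eq_one.1 h
  have hfst : ∀ a ∈ A, a.1 = c := fun a ha =>
    Finset.mem_singleton.1 (hc ▸ Finset.mem_image_of_mem Prod.fst ha)
  refine ⟨c, Finset.ext fun ⟨x, y⟩ => ?_⟩
  simp only [Finset.mem_filter, Finset.mem_univ, true_and]
  constructor
  · intro hxy
    exact ⟨hfst _ hxy, fun hy => harc _ hxy ((hfst _ hxy).trans hy.symm)⟩
  · rintro ⟨rfl, hy⟩
    rcases hni y with h | h
    · obtain ⟨a, ha⟩ := Finset.card_pos.1 (Nat.pos_of_ne_zero h)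
      obtain ⟨ha, hay⟩ := Finset.mem_filter.1 ha
      exact absurd (hay.symm.trans (hfst a ha)) hy
    · obtain ⟨a, ha⟩ := Finset.card_pos.1 (Nat.pos_of_ne_zero h)
      obtain ⟨ha', rfl⟩ := Finset.mem_filter.1 ha
      rwa [← hfst a ha']

theorem isStarIn_of_card_image_snd (harc : ∀ a ∈ A, a.1 ≠ a.2)
    (hni : ∀ u : Fin n, outDeg A u ≠ 0 ∨ inDeg A u ≠ 0) (h : #(A.image Prod.snd) = 1) :
    IsStarIn A := by
  obtain ⟨c, hc⟩ := Finset.card_eq_one.1 h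
  have hsnd : ∀ a ∈ A, a.2 = c := fun a ha =>
    Finset.mem_singleton.1 (hc ▸ Finset.mem_image_of_mem Prod.snd ha)
  refine ⟨c, Finset.ext fun ⟨x, y⟩ => ?_⟩
  simp only [Finset.mem_filter, Finset.mem_univ, true_and]
  constructor
  · intro hxy
    exact ⟨hsnd _ hxy, fun hx => harc _ hxy (hx.trans (hsnd _ hxy).symm)⟩
  · rintro ⟨rfl, hx⟩
    rcases hni x with h | h
    · obtain ⟨a, ha⟩ := Finset.card_pos.1 (Nat.pos_of_ne_zero h)
      obtain ⟨ha', rfl⟩ := Finset.mem_filter.1 ha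
      rwa [← hsnd a ha']
    · obtain ⟨a, ha⟩ := Finset.card_pos.1 (Nat.pos_of_ne_zero h)
      obtain ⟨ha, hax⟩ := Finset.mem_filter.1 ha
      exact absurd (hax.symm.trans (hsnd a ha)) hx

theorem arcSum_of_isStarOut (α : ℝ) (h : IsStarOut A) : arcSum α A = starSum α n := by
  obtain ⟨c, hA⟩ := h
  have hn : 0 < n := c.pos
  have hmem : ∀ a, a ∈ A ↔ a.1 = c ∧ a.2 ≠ c := fun a => by simp [hA]
  have hcard : #A = n - 1 := by
    have : A = (Finset.univ.erase c).map ⟨fun y => (c, y), Prod.mk_right_injective c⟩ := by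
      ext ⟨x, y⟩
      simp only [hmem, Finset.mem_map, Finset.mem_erase, Finset.mem_univ, and_true,
        Function.Embedding.coeFn_mk, Prod.mk.injEq]
      constructor
      · rintro ⟨rfl, hy⟩
        exact ⟨y, hy, rfl, rfl⟩
      · rintro ⟨z, hz, rfl, rfl⟩
        exact ⟨rfl, hz⟩
    rw [this, Finset.card_map, Finset.card_erase_of_mem (Finset.mem_univ c), Finset.card_fin]
  have hterm : ∀ a ∈ A, ((outDeg A a.1 : ℝ) + (inDeg A a.2 : ℝ)) ^ α = (n : ℝ) ^ α := by
    intro a ha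
    have ho : outDeg A a.1 = n - 1 := by
      rw [outDeg, Finset.filter_true_of_mem, hcard]
      exact fun b hb => ((hmem b).1 hb).1.trans ((hmem a).1 ha).1.symm
    have hi : inDeg A a.2 = 1 := by
      rw [inDeg, Finset.card_eq_one]
      refine ⟨a, Finset.ext fun b => ?_⟩
      simp only [Finset.mem_filter, Finset.mem_singleton]
      refine ⟨fun hb => Prod.ext (((hmem b).1 hb.1).1.trans ((hmem a).1 ha).1.symm) hb.2, ?_⟩
      rintro rfl
      exact ⟨ha, rfl⟩
    rw [ho, hi, ← Nat.cast_add, Nat.sub_add_cancel hn]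
  rw [arcSum, Finset.sum_congr rfl hterm, Finset.sum_const, hcard, nsmul_eq_mul, starSum,
    Nat.cast_pred hn]

theorem arcSum_map_swap (α : ℝ) (A : Finset (Fin n × Fin n)) :
    arcSum α (A.map (Equiv.prodComm _ _).toEmbedding) = arcSum α A := by
  have ho : ∀ u, outDeg (A.map (Equiv.prodComm _ _).toEmbedding) u = inDeg A u := fun u => by
    rw [outDeg, inDeg, Finset.filter_map, Finset.card_map]
    rfl
  have hi : ∀ u, inDeg (A.map (Equiv.prodComm _ _).toEmbedding) u = outDeg A u := fun u => by
    rw [outDeg, inDeg, Finset.filter_map, Finset.card_map]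
    rfl
  simp only [arcSum, Finset.sum_map, ho, hi]
  exact Finset.sum_congr rfl fun a _ => by rw [add_comm]; rfl

theorem arcSum_of_isStarIn (α : ℝ) (h : IsStarIn A) : arcSum α A = starSum α n := by
  rw [← arcSum_map_swap]
  refine arcSum_of_isStarOut α ?_
  obtain ⟨c, rfl⟩ := h
  refine ⟨c, Finset.ext fun ⟨x, y⟩ => ?_⟩
  simp only [Finset.mem_map_equiv, Finset.mem_filter, Finset.mem_univ, true_and]
  rfl

end ArcSum

theorem stmt13 (n : ℕ) (hn : 6 ≤ n) (α : ℝ) (hα₁ : -1 ≤ α) (hα₂ : α ≤ -(1 / 2))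
    (A : Finset (Fin n × Fin n)) (harc : ∀ a ∈ A, a.1 ≠ a.2)
    (hni : ∀ u : Fin n, outDeg A u ≠ 0 ∨ inDeg A u ≠ 0) :
    (1 / 2 : ℝ) * ((n : ℝ) - 1) * (n : ℝ) ^ α ≤ vdbI A (fun x y => ((x : ℝ) + (y : ℝ)) ^ α) ∧
      (vdbI A (fun x y => ((x : ℝ) + (y : ℝ)) ^ α) = (1 / 2 : ℝ) * ((n : ℝ) - 1) * (n : ℝ) ^ α ↔ IsStarOut A ∨ IsStarIn A) := by
  have hα : α < 0 := by linarith
  have hI : vdbI A (fun x y => ((x : ℝ) + (y : ℝ)) ^ α) = 1 / 2 * arcSum α A := rfl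
  have hS : (1 / 2 : ℝ) * ((n : ℝ) - 1) * (n : ℝ) ^ α = 1 / 2 * starSum α n := by
    rw [starSum, mul_assoc]
  have hN := card_le_card_images_add hni
  have hmono := starSum_mono hα₁ hα (by omega) hN
  rw [hI, hS]
  rcases starSum_le_arcSum hα₁ hα₂ A with ⟨-, h, -⟩ | ⟨hle, heq⟩
  · omega
  refine ⟨by linarith, fun h => ?_, ?_⟩
  · rcases heq (by linarith) with h | h | h
    · omega
    · exact Or.inl (isStarOut_of_card_image_fst harc hni h)
    · exact Or.inr (isStarIn_of_card_image_snd harc hni h)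
  · rintro (h | h)
    · rw [arcSum_of_isStarOut α h]
    · rw [arcSum_of_isStarIn α h]
end

section
/- Let n ≥ 3. Then for every digraph D on n vertices without isolated vertices, h(D) ≥ (n−1)/n, and equality holds if and only if D is isomorphic to K⃗_{1,n−1} or to K⃗_{n−1,1}. -/
open Finset

theorem sum_one_div_card_fiber {α β : Type*} [DecidableEq β] (A : Finset α) (f : α → β) :
    ∑ a ∈ A, (1 : ℝ) / ((A.filter (fun x => f x = f a)).card : ℝ) = ((A.image f).card : ℝ) := by
  rw [← Finset.sum_fiberwise_of_maps_to (g := f) (t := A.image f)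
    (fun a ha => Finset.mem_image_of_mem f ha)]
  rw [Finset.card_eq_sum_ones, Nat.cast_sum]
  refine Finset.sum_congr rfl fun b hb => ?_
  obtain ⟨a, ha, rfl⟩ := Finset.mem_image.1 hb
  have hpos : ((A.filter (fun x => f x = f a)).card : ℝ) ≠ 0 := by
    exact_mod_cast (Finset.card_pos.2 ⟨a, by simp [ha]⟩).ne'
  rw [Finset.sum_congr rfl (g := fun _ => (1 : ℝ) / ((A.filter (fun x => f x = f a)).card : ℝ))
    (fun x hx => by rw [(Finset.mem_filter.1 hx).2])]
  rw [Finset.sum_const, nsmul_eq_mul]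
  simp [hpos]

theorem harmonic_weight_identity {a b N : ℝ} (ha : 1 ≤ a) (hb : 1 ≤ b) (hN : a + b ≤ N) :
    2 / (a + b) - 2 * (N - 1) / N ^ 2 * (1 / a + 1 / b) =
      2 * ((a - 1) * (b - 1) * N ^ 2 + (N - (a + b)) * ((a + b - 1) * (N - 1) - 1)) /
        (a * b * (a + b) * N ^ 2) := by
  have h1 : a ≠ 0 := by positivity
  have h2 : b ≠ 0 := by positivity
  have h3 : a + b ≠ 0 := by positivity
  have h4 : N ≠ 0 := by linarith
  field_simp
  ring

theorem harmonic_weight_le {a b N : ℝ} (ha : 1 ≤ a) (hb : 1 ≤ b) (hN : a + b ≤ N) :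
    2 * (N - 1) / N ^ 2 * (1 / a + 1 / b) ≤ 2 / (a + b) := by
  rw [← sub_nonneg, harmonic_weight_identity ha hb hN]
  have h1 : 0 ≤ (a - 1) * (b - 1) := mul_nonneg (by linarith) (by linarith)
  have h2 : 0 ≤ (N - (a + b)) * ((a + b - 1) * (N - 1) - 1) :=
    mul_nonneg (by linarith) (by nlinarith)
  positivity

theorem eq_of_harmonic_weight_eq {a b N : ℝ} (ha : 1 ≤ a) (hb : 1 ≤ b) (hN : a + b ≤ N)
    (h : 2 * (N - 1) / N ^ 2 * (1 / a + 1 / b) = 2 / (a + b)) :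
    a + b = N ∧ (a = 1 ∨ b = 1) := by
  have h0 := harmonic_weight_identity ha hb hN
  have hN0 : 0 < N := by linarith
  have hden : a * b * (a + b) * N ^ 2 ≠ 0 := by positivity
  rw [h, sub_self, eq_comm, div_eq_zero_iff, or_iff_left hden] at h0
  have h1 : 0 ≤ (a - 1) * (b - 1) := mul_nonneg (by linarith) (by linarith)
  have h1' : 0 ≤ (a - 1) * (b - 1) * N ^ 2 := by positivity
  have h2 : 0 ≤ (N - (a + b)) * ((a + b - 1) * (N - 1) - 1) :=
    mul_nonneg (by linarith) (by nlinarith)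
  have h3 : (a - 1) * (b - 1) * N ^ 2 = 0 := by linarith
  have h4 : (N - (a + b)) * ((a + b - 1) * (N - 1) - 1) = 0 := by linarith
  constructor
  · rcases mul_eq_zero.1 h4 with h | h
    · linarith
    · nlinarith
  · rcases mul_eq_zero.1 h3 with h | h
    · rcases mul_eq_zero.1 h with h | h
      · left; linarith
      · right; linarith
    · exact absurd h (by positivity)

section

variable {n : ℕ} {A : Finset (Fin n × Fin n)}

theorem outDeg_pos_s19 {a : Fin n × Fin n} (ha : a ∈ A) : 1 ≤ outDeg A a.1 :=
  Finset.card_pos.2 ⟨a, by simp [ha]⟩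

theorem inDeg_pos_s19 {a : Fin n × Fin n} (ha : a ∈ A) : 1 ≤ inDeg A a.2 :=
  Finset.card_pos.2 ⟨a, by simp [ha]⟩

theorem outDeg_le_card_heads (u : Fin n) : outDeg A u ≤ (A.image Prod.snd).card := by
  refine Finset.card_le_card_of_injOn Prod.snd
    (fun a ha => Finset.mem_image_of_mem _ (Finset.mem_filter.1 ha).1) ?_
  intro a ha b hb hab
  simp only [Finset.coe_filter, Set.mem_ofPred_eq] at ha hb
  exact Prod.ext (ha.2.trans hb.2.symm) hab

theorem inDeg_le_card_tails (v : Fin n) : inDeg A v ≤ (A.image Prod.fst).card := by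
  refine Finset.card_le_card_of_injOn Prod.fst
    (fun a ha => Finset.mem_image_of_mem _ (Finset.mem_filter.1 ha).1) ?_
  intro a ha b hb hab
  simp only [Finset.coe_filter, Set.mem_ofPred_eq] at ha hb
  exact Prod.ext hab (ha.2.trans hb.2.symm)

theorem le_card_tails_add_card_heads (hni : ∀ u : Fin n, outDeg A u ≠ 0 ∨ inDeg A u ≠ 0) :
    n ≤ (A.image Prod.fst).card + (A.image Prod.snd).card := by
  have h : A.image Prod.fst ∪ A.image Prod.snd = Finset.univ := by
    refine Finset.eq_univ_iff_forall.2 fun u => Finset.mem_union.2 ?_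
    refine (hni u).imp (fun h => ?_) (fun h => ?_) <;>
    · obtain ⟨a, ha⟩ := Finset.card_pos.1 (Nat.pos_of_ne_zero h)
      rw [Finset.mem_filter] at ha
      exact Finset.mem_image.2 ⟨a, ha⟩
  calc n = (A.image Prod.fst ∪ A.image Prod.snd).card := by rw [h]; simp
    _ ≤ _ := Finset.card_union_le _ _

/-- If a single vertex sends arcs to all others, and the numbers of tails and of heads add up to `n`,
then there is no other tail. -/
theorem isStarOut_of_outDeg_eq (hn : 2 ≤ n) (harc : ∀ a ∈ A, a.1 ≠ a.2)
    (hN : (A.image Prod.fst).card + (A.image Prod.snd).card = n) {u : Fin n}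
    (hu : outDeg A u = n - 1) : IsStarOut A := by
  have hq := outDeg_le_card_heads (A := A) u
  have hutail : u ∈ A.image Prod.fst := by
    obtain ⟨a, ha⟩ := Finset.card_pos.1 (show 0 < outDeg A u by omega)
    rw [Finset.mem_filter] at ha
    exact Finset.mem_image.2 ⟨a, ha⟩
  have huniq : ∀ a ∈ A, a.1 = u := fun a ha =>
    Finset.card_le_one.1 (show (A.image Prod.fst).card ≤ 1 by omega) _
      (Finset.mem_image_of_mem _ ha) _ hutail
  refine ⟨u, Finset.eq_of_subset_of_card_le (fun a ha => ?_) ?_⟩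
  · have h1 := huniq a ha
    have h2 := harc a ha
    simp only [Finset.mem_filter, Finset.mem_univ, true_and]
    exact ⟨h1, fun h => h2 (h1.trans h.symm)⟩
  · have hA : n - 1 ≤ A.card := hu ▸ Finset.card_le_card (Finset.filter_subset _ _)
    refine le_trans ?_ hA
    have hc : (Finset.univ.erase u).card = n - 1 := by simp
    rw [← hc]
    refine Finset.card_le_card_of_injOn Prod.snd (fun a ha => ?_) ?_
    · simp only [Finset.coe_filter, Finset.mem_univ, true_and, Set.mem_ofPred_eq] at ha
      simp [ha.2]
    · intro a ha b hb hab
      simp only [Finset.coe_filter, Finset.mem_univ, true_and, Set.mem_ofPred_eq] at ha hb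
      exact Prod.ext (ha.1.trans hb.1.symm) hab

theorem outDeg_image_swap (u : Fin n) : outDeg (A.image Prod.swap) u = inDeg A u := by
  unfold outDeg inDeg
  rw [Finset.filter_image, Finset.card_image_of_injective _ Prod.swap_injective]
  simp

theorem inDeg_image_swap (u : Fin n) : inDeg (A.image Prod.swap) u = outDeg A u := by
  unfold outDeg inDeg
  rw [Finset.filter_image, Finset.card_image_of_injective _ Prod.swap_injective]
  simp

theorem isStarOut_image_swap : IsStarOut (A.image Prod.swap) ↔ IsStarIn A := by
  refine exists_congr fun c => ?_
  simp only [Finset.ext_iff, Prod.forall, Finset.mem_image, Finset.mem_filter, Finset.mem_univ,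
    true_and, Prod.exists, Prod.swap_prod_mk, Prod.mk.injEq]
  constructor
  · intro h a b
    rw [← h b a]
    exact ⟨fun h => ⟨a, b, h, rfl, rfl⟩, by rintro ⟨_, _, h, rfl, rfl⟩; exact h⟩
  · intro h a b
    rw [← h b a]
    exact ⟨by rintro ⟨_, _, h, rfl, rfl⟩; exact h, fun h => ⟨b, a, h, rfl, rfl⟩⟩

theorem vdbI_image_swap (φ : ℕ → ℕ → ℝ) :
    vdbI (A.image Prod.swap) φ = vdbI A (fun x y => φ y x) := by
  unfold vdbI
  rw [Finset.sum_image Prod.swap_injective.injOn]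
  simp only [outDeg_image_swap, inDeg_image_swap, Prod.fst_swap, Prod.snd_swap]

theorem isStarIn_of_inDeg_eq (hn : 2 ≤ n) (harc : ∀ a ∈ A, a.1 ≠ a.2)
    (hN : (A.image Prod.fst).card + (A.image Prod.snd).card = n) {v : Fin n}
    (hv : inDeg A v = n - 1) : IsStarIn A := by
  rw [← isStarOut_image_swap]
  refine isStarOut_of_outDeg_eq hn ?_ ?_ (u := v) (by rw [outDeg_image_swap, hv])
  · intro a ha
    obtain ⟨b, hb, rfl⟩ := Finset.mem_image.1 ha
    exact (harc b hb).symm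
  · rw [Finset.image_image, Finset.image_image, add_comm]
    exact hN

theorem vdbI_harmonic_of_isStarOut (hn : 1 ≤ n) (h : IsStarOut A) :
    vdbI A (fun x y => 2 / ((x : ℝ) + (y : ℝ))) = ((n : ℝ) - 1) / n := by
  obtain ⟨c, hc⟩ := h
  have hmem : ∀ a, a ∈ A ↔ a.1 = c ∧ a.2 ≠ c := by simp [hc]
  have hcard : A.card = n - 1 := by
    have : A = (Finset.univ.erase c).image (Prod.mk c) := by
      ext ⟨a, b⟩
      simp only [hmem, Finset.mem_image, Finset.mem_erase, Finset.mem_univ, and_true,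
        Prod.mk.injEq, ne_eq]
      exact ⟨fun h => ⟨b, h.2, h.1.symm, rfl⟩, by rintro ⟨x, hx, rfl, rfl⟩; exact ⟨rfl, hx⟩⟩
    rw [this, Finset.card_image_of_injective _ (Prod.mk_right_injective c)]
    simp
  have hout : outDeg A c = n - 1 := by
    rw [← hcard, outDeg, Finset.filter_true_of_mem fun a ha => ((hmem a).1 ha).1]
  have hin : ∀ a ∈ A, inDeg A a.2 = 1 := fun a ha => by
    refine Finset.card_eq_one.2 ⟨a, Finset.ext fun b => ?_⟩
    rw [Finset.mem_filter, Finset.mem_singleton]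
    refine ⟨fun hb => Prod.ext ?_ hb.2, by rintro rfl; exact ⟨ha, rfl⟩⟩
    rw [((hmem _).1 ha).1, ((hmem _).1 hb.1).1]
  unfold vdbI
  rw [Finset.sum_congr rfl (g := fun _ => (2 : ℝ) / n) fun a ha => by
    rw [hin a ha, ((hmem a).1 ha).1, hout]; push_cast [Nat.cast_sub hn]; simp]
  rw [Finset.sum_const, hcard, nsmul_eq_mul, Nat.cast_sub hn]
  push_cast
  ring

theorem vdbI_harmonic_of_isStarIn (hn : 1 ≤ n) (h : IsStarIn A) :
    vdbI A (fun x y => 2 / ((x : ℝ) + (y : ℝ))) = ((n : ℝ) - 1) / n := by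
  rw [← vdbI_harmonic_of_isStarOut hn (isStarOut_image_swap.2 h), vdbI_image_swap]
  simp only [add_comm]

/-- The total weight of the arcs bounding the harmonic index from below. -/
theorem half_sum_harmonic_weight (A : Finset (Fin n × Fin n)) {N : ℝ} (hN0 : N ≠ 0)
    (hN : ((A.image Prod.fst).card : ℝ) + ((A.image Prod.snd).card : ℝ) = N) :
    (1 / 2 : ℝ) * ∑ a ∈ A, 2 * (N - 1) / N ^ 2 *
      (1 / (outDeg A a.1 : ℝ) + 1 / (inDeg A a.2 : ℝ)) = (N - 1) / N := by
  have h1 : ∑ a ∈ A, (1 : ℝ) / (outDeg A a.1 : ℝ) = (A.image Prod.fst).card :=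
    sum_one_div_card_fiber A Prod.fst
  have h2 : ∑ a ∈ A, (1 : ℝ) / (inDeg A a.2 : ℝ) = (A.image Prod.snd).card :=
    sum_one_div_card_fiber A Prod.snd
  rw [← Finset.mul_sum, Finset.sum_add_distrib, h1, h2, hN]
  field_simp

end

theorem stmt19 (n : ℕ) (hn : 3 ≤ n)
    (A : Finset (Fin n × Fin n)) (harc : ∀ a ∈ A, a.1 ≠ a.2)
    (hni : ∀ u : Fin n, outDeg A u ≠ 0 ∨ inDeg A u ≠ 0) :
    ((n : ℝ) - 1) / n ≤ vdbI A (fun x y => 2 / ((x : ℝ) + (y : ℝ))) ∧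
      (vdbI A (fun x y => 2 / ((x : ℝ) + (y : ℝ))) = ((n : ℝ) - 1) / n ↔ IsStarOut A ∨ IsStarIn A) := by
  obtain ⟨N, hN⟩ : ∃ N, (A.image Prod.fst).card + (A.image Prod.snd).card = N := ⟨_, rfl⟩
  have hnN : n ≤ N := hN ▸ le_card_tails_add_card_heads hni
  have hn0 : (0 : ℝ) < n := by exact_mod_cast (by omega : 0 < n)
  have hnN' : (n : ℝ) ≤ N := by exact_mod_cast hnN
  have hN0 : (0 : ℝ) < N := hn0.trans_le hnN'
  have hsum := half_sum_harmonic_weight A hN0.ne' (by exact_mod_cast hN)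
  have ho : ∀ a ∈ A, (1 : ℝ) ≤ outDeg A a.1 := fun a ha => by exact_mod_cast outDeg_pos_s19 ha
  have hi : ∀ a ∈ A, (1 : ℝ) ≤ inDeg A a.2 := fun a ha => by exact_mod_cast inDeg_pos_s19 ha
  have hs : ∀ a ∈ A, (outDeg A a.1 : ℝ) + inDeg A a.2 ≤ N := fun a _ => by
    have h1 := outDeg_le_card_heads (A := A) a.1
    have h2 := inDeg_le_card_tails (A := A) a.2
    exact_mod_cast (by omega : outDeg A a.1 + inDeg A a.2 ≤ N)
  have hle := fun a ha => harmonic_weight_le (ho a ha) (hi a ha) (hs a ha)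
  have hfrac : ((n : ℝ) - 1) / n ≤ ((N : ℝ) - 1) / N := by
    rw [div_le_div_iff₀ hn0 hN0]
    linarith
  have hbound : ((N : ℝ) - 1) / N ≤ vdbI A (fun x y => 2 / ((x : ℝ) + (y : ℝ))) := by
    rw [← hsum]
    exact mul_le_mul_of_nonneg_left (Finset.sum_le_sum hle) (by norm_num)
  refine ⟨hfrac.trans hbound, fun heq => ?_, ?_⟩
  · have hfeq : ((n : ℝ) - 1) / n = ((N : ℝ) - 1) / N := le_antisymm hfrac (heq ▸ hbound)
    have hNn : N = n := by
      rw [div_eq_div_iff hn0.ne' hN0.ne'] at hfeq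
      exact_mod_cast (by linarith : (N : ℝ) = n)
    rw [hfeq, ← hsum, vdbI] at heq
    have hterm := (Finset.sum_eq_sum_iff_of_le hle).1
      (mul_left_cancel₀ (by norm_num) heq).symm
    obtain ⟨a, ha⟩ : A.Nonempty := by
      refine Finset.nonempty_iff_ne_empty.2 fun h => ?_
      simp [h] at hN
      omega
    obtain ⟨hadd, hone⟩ :=
      eq_of_harmonic_weight_eq (ho a ha) (hi a ha) (hs a ha) (hterm a ha)
    have hadd' : outDeg A a.1 + inDeg A a.2 = N := by exact_mod_cast hadd
    have hN' := hN.trans hNn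
    rcases hone with h | h
    · have h' : outDeg A a.1 = 1 := by exact_mod_cast h
      exact Or.inr (isStarIn_of_inDeg_eq (by omega) harc hN' (v := a.2) (by omega))
    · have h' : inDeg A a.2 = 1 := by exact_mod_cast h
      exact Or.inl (isStarOut_of_outDeg_eq (by omega) harc hN' (u := a.1) (by omega))
  · rintro (h | h)
    · exact vdbI_harmonic_of_isStarOut (by omega) h
    · exact vdbI_harmonic_of_isStarIn (by omega) h
end
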